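/- arXiv:1111.0046 — 3 statements merged into one kernel-verified Lean document; each statement's English description precedes it below -/
import Mathlib

section
/- In the static (single-period) trade-reduction DA, reporting its true value is a dominant strategy for every buyer and every seller: no agent can strictly increase its utility (value of trade minus payment, with payments negative for sellers) by reporting a value different from its true value, whatever the reports of the other agents. -/
/-!
STATEMENT 1: In the static (single-period) trade-reduction DA, reporting its true
value is a dominant strategy for every buyer and every seller.

The trade-reduction DA is formalized as follows.  `bSeq b k` is the `k`-th entry of
the descending sequence of bid values, with the dummy bid `+∞` at index `0` and `⊥`
beyond the real bids; `sSeq s k` is the analogous ask sequence with the dummy ask `0`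
at index `0`.  `mIdx` is the index of the last efficient bid–ask pair.  When
`mIdx ≥ 2`, the bids and asks of rank `1, …, mIdx − 1` trade; winning buyers pay
`ŵ_{b_m}` and winning sellers make (negative) payment `ŵ_{s_m}` (i.e. they receive
`-ŵ_{s_m}`).  Ties between equal values are broken by index.
-/

open Finset

attribute [local instance] Classical.propDecidable

noncomputable section

namespace TRDA

variable {nb ns : ℕ}

/-- `k`-th entry of the descending sequence of bid values (dummy `+∞` at index 0,
`⊥` past the real bids). -/
def bSeq (b : Fin nb → ℝ) (k : ℕ) : EReal :=
  sSup {x : EReal | k ≤ (univ.filter fun j => x ≤ (b j : EReal)).card}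

/-- `k`-th entry of the descending sequence of ask values (dummy `0` at index 0,
`⊥` past the real asks); asks are nonpositive. -/
def sSeq (s : Fin ns → ℝ) (k : ℕ) : EReal :=
  min 0 (sSup {x : EReal | k ≤ (univ.filter fun j => x ≤ (s j : EReal)).card})

/-- Index `m ≥ 0` of the last bid–ask pair clearing in the efficient trade:
the largest `k` with `ŵ_{b_k} + ŵ_{s_k} ≥ 0`. -/
def mIdx (b : Fin nb → ℝ) (s : Fin ns → ℝ) : ℕ :=
  sSup {k : ℕ | 0 ≤ bSeq b k + sSeq s k}

/-- Rank of bid `i` among the real bids (rank 1 = highest; ties broken by index, and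
the dummy bid `+∞` occupies rank 0). -/
def rankB (b : Fin nb → ℝ) (i : Fin nb) : ℕ :=
  1 + (univ.filter fun j => b i < b j ∨ (b j = b i ∧ j < i)).card

/-- Rank of ask `j` among the real asks. -/
def rankS (s : Fin ns → ℝ) (j : Fin ns) : ℕ :=
  1 + (univ.filter fun k => s j < s k ∨ (s k = s j ∧ k < j)).card

/-- Buyer `i` trades in the trade-reduction DA: `m ≥ 2` and its rank is at most `m-1`. -/
def buyerTrades (b : Fin nb → ℝ) (s : Fin ns → ℝ) (i : Fin nb) : Prop :=
  2 ≤ mIdx b s ∧ rankB b i < mIdx b s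

/-- Seller `j` trades in the trade-reduction DA. -/
def sellerTrades (b : Fin nb → ℝ) (s : Fin ns → ℝ) (j : Fin ns) : Prop :=
  2 ≤ mIdx b s ∧ rankS s j < mIdx b s

/-- Payment `ŵ_{b_m}` collected from each winning buyer. -/
def buyerPrice (b : Fin nb → ℝ) (s : Fin ns → ℝ) : ℝ := (bSeq b (mIdx b s)).toReal

/-- Payment `ŵ_{s_m}` (nonpositive) made by each winning seller: it receives
`-ŵ_{s_m}`. -/
def sellerPrice (b : Fin nb → ℝ) (s : Fin ns → ℝ) : ℝ := (sSeq s (mIdx b s)).toReal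

/-- Utility of buyer `i` whose true value is `w`. -/
def buyerUtil (b : Fin nb → ℝ) (s : Fin ns → ℝ) (i : Fin nb) (w : ℝ) : ℝ :=
  if buyerTrades b s i then w - buyerPrice b s else 0

/-- Utility of seller `j` whose true value is `w ≤ 0`. -/
def sellerUtil (b : Fin nb → ℝ) (s : Fin ns → ℝ) (j : Fin ns) (w : ℝ) : ℝ :=
  if sellerTrades b s j then w - sellerPrice b s else 0

/-- Common order-statistic sequence of bids and asks. -/
def auxS {n : ℕ} (a : Fin n → ℝ) (k : ℕ) : EReal :=
  sSup {x : EReal | k ≤ (univ.filter fun j => x ≤ (a j : EReal)).card}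

/-- Common rank. -/
def auxR {n : ℕ} (a : Fin n → ℝ) (i : Fin n) : ℕ :=
  1 + (univ.filter fun j => a i < a j ∨ (a j = a i ∧ j < i)).card

theorem auxS_le {n : ℕ} (a : Fin n → ℝ) (i : Fin n) (m : ℕ) (h : auxR a i < m) :
    auxS a m ≤ (a i : EReal) := by
  apply sSup_le
  intro x hx
  simp only [Set.mem_setOf_eq] at hx
  by_contra hlt
  push Not at hlt
  have : (univ.filter fun j => x ≤ (a j : EReal)).card ≤
      (univ.filter fun j => a i < a j ∨ (a j = a i ∧ j < i)).card := by
    apply card_le_card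
    intro j hj
    simp only [mem_filter, mem_univ, true_and] at hj ⊢
    left
    exact_mod_cast lt_of_lt_of_le hlt hj
  unfold auxR at h
  omega

theorem auxS_real {n : ℕ} (a : Fin n → ℝ) (m : ℕ) (h1 : 1 ≤ m) (h : auxS a m ≠ ⊥) :
    ∃ p : ℝ, auxS a m = p := by
  have htop : auxS a m ≠ ⊤ := by
    obtain ⟨M, hM⟩ := (Set.finite_range a).bddAbove
    have : auxS a m ≤ (M : EReal) := by
      apply sSup_le
      intro x hx
      simp only [Set.mem_setOf_eq] at hx
      have hp : 0 < (univ.filter fun j => x ≤ (a j : EReal)).card := by omega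
      obtain ⟨j, hj⟩ := card_pos.mp hp
      simp only [mem_filter, mem_univ, true_and] at hj
      refine hj.trans ?_
      exact_mod_cast hM ⟨j, rfl⟩
    exact ne_top_of_le_ne_top (EReal.coe_ne_top M) this
  exact ⟨(auxS a m).toReal, (EReal.coe_toReal htop h).symm⟩

theorem auxS_zero {n : ℕ} (a : Fin n → ℝ) : auxS a 0 = ⊤ := by
  simp [auxS]

theorem auxS_big {n : ℕ} (a : Fin n → ℝ) (k : ℕ) (h : n < k) : auxS a k = ⊥ := by
  rw [auxS, sSup_eq_bot]
  intro x hx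
  simp only [Set.mem_setOf_eq] at hx
  have := card_le_univ (univ.filter fun j => x ≤ (a j : EReal))
  simp only [Fintype.card_fin] at this
  omega

theorem aux_core {n : ℕ} (a : Fin n → ℝ) (i : Fin n) (v w p : ℝ) (m : ℕ)
    (hr : auxR (Function.update a i v) i < m)
    (hp : auxS (Function.update a i v) m = p) (hw : p < w) :
    auxR (Function.update a i w) i < m ∧
    ∀ k, m ≤ k → auxS (Function.update a i w) k = auxS (Function.update a i v) k := by
  have hpv : p ≤ v := by
    have := auxS_le _ i m hr
    rw [hp] at this
    simpa using this
  have hcard : ∀ x : EReal, (p : EReal) < x →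
      (univ.filter fun j => j ≠ i ∧ x ≤ (a j : EReal)).card + 1 < m := by
    intro x hx
    by_cases hxv : x ≤ (v : EReal)
    · have h1 : (univ.filter fun j => x ≤ ((Function.update a i v) j : EReal)).card < m := by
        by_contra hc
        push Not at hc
        have : x ≤ auxS (Function.update a i v) m := le_sSup hc
        rw [hp] at this
        exact absurd hx (not_lt.mpr this)
      refine lt_of_le_of_lt ?_ h1
      rw [← card_insert_of_notMem (a := i) (by simp)]
      apply card_le_card
      intro j hj
      simp only [mem_insert, mem_filter, mem_univ, true_and] at hj ⊢
      rcases hj with rfl | ⟨hj, hj2⟩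
      · simpa using hxv
      · simpa [Function.update_of_ne hj] using hj2
    · push Not at hxv
      unfold auxR at hr
      refine lt_of_le_of_lt ?_ hr
      rw [add_comm]
      apply Nat.add_le_add_left
      apply card_le_card
      intro j hj
      simp only [mem_filter, mem_univ, true_and] at hj ⊢
      left
      rw [Function.update_self, Function.update_of_ne hj.1]
      exact_mod_cast lt_of_lt_of_le hxv hj.2
  have hcard2 : ∀ (u : ℝ) (x : EReal), (p : EReal) < x →
      (univ.filter fun j => x ≤ ((Function.update a i u) j : EReal)).card < m := by
    intro u x hx
    refine lt_of_le_of_lt ?_ (hcard x hx)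
    rw [← card_insert_of_notMem (a := i) (by simp)]
    apply card_le_card
    intro j hj
    simp only [mem_insert, mem_filter, mem_univ, true_and] at hj ⊢
    by_cases hji : j = i
    · exact Or.inl hji
    · rw [Function.update_of_ne hji] at hj
      exact Or.inr ⟨hji, hj⟩
  constructor
  · have := hcard (w : EReal) (by exact_mod_cast hw)
    refine lt_of_le_of_lt ?_ this
    unfold auxR
    rw [add_comm]
    apply Nat.add_le_add_right
    apply card_le_card
    intro j hj
    simp only [mem_filter, mem_univ, true_and] at hj ⊢
    have hji : j ≠ i := by
      rintro rfl
      simp at hj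
    rw [Function.update_self, Function.update_of_ne hji] at hj
    refine ⟨hji, ?_⟩
    rcases hj with hj | hj
    · exact_mod_cast hj.le
    · exact_mod_cast hj.1.ge
  · intro k hk
    unfold auxS
    congr 1
    ext x
    simp only [Set.mem_setOf_eq]
    by_cases hx : x ≤ (p : EReal)
    · have : (univ.filter fun j => x ≤ ((Function.update a i w) j : EReal)) =
          (univ.filter fun j => x ≤ ((Function.update a i v) j : EReal)) := by
        ext j
        simp only [mem_filter, mem_univ, true_and]
        by_cases hji : j = i
        · subst hji
          simp only [Function.update_self]
          have e1 : x ≤ (w : EReal) := hx.trans (by exact_mod_cast hw.le)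
          have e2 : x ≤ (v : EReal) := hx.trans (by exact_mod_cast hpv)
          simp [e1, e2]
        · simp only [Function.update_of_ne hji]
      rw [this]
    · push Not at hx
      have h1 := hcard2 w x hx
      have h2 := hcard2 v x hx
      constructor <;> intro h <;> omega

theorem aux_bdd (b : Fin nb → ℝ) (s : Fin ns → ℝ) :
    BddAbove {k : ℕ | 0 ≤ bSeq b k + sSeq s k} := by
  refine ⟨nb, fun k hk => ?_⟩
  by_contra h
  push Not at h
  have h2 : bSeq b k = ⊥ := auxS_big b k h
  simp [h2] at hk

theorem aux_mem (b : Fin nb → ℝ) (s : Fin ns → ℝ) :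
    0 ≤ bSeq b (mIdx b s) + sSeq s (mIdx b s) := by
  have hne : {k : ℕ | 0 ≤ bSeq b k + sSeq s k}.Nonempty := by
    refine ⟨0, ?_⟩
    have h1 : bSeq b 0 = ⊤ := auxS_zero b
    have h2 : sSeq s 0 = min 0 ⊤ := congrArg (min 0) (auxS_zero s)
    simp [h1, h2]
  exact Nat.sSup_mem hne (aux_bdd b s)

theorem aux_mIdx_eq {nb' ns' : ℕ} (b : Fin nb → ℝ) (s : Fin ns → ℝ)
    (b' : Fin nb' → ℝ) (s' : Fin ns' → ℝ)
    (hb : ∀ k, mIdx b s ≤ k → bSeq b' k = bSeq b k)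
    (hs : ∀ k, mIdx b s ≤ k → sSeq s' k = sSeq s k) : mIdx b' s' = mIdx b s := by
  have h1 : mIdx b s ≤ mIdx b' s' := by
    refine le_csSup (aux_bdd b' s') ?_
    simp only [Set.mem_setOf_eq]
    rw [hb _ le_rfl, hs _ le_rfl]
    exact aux_mem b s
  refine le_antisymm ?_ h1
  have h2 := aux_mem b' s'
  rw [hb _ h1, hs _ h1] at h2
  exact le_csSup (aux_bdd b s) h2

theorem aux_b_real (b : Fin nb → ℝ) (s : Fin ns → ℝ) (h : 2 ≤ mIdx b s) :
    ∃ p : ℝ, auxS b (mIdx b s) = p := by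
  apply auxS_real _ _ (by omega)
  intro h0
  have h1 := aux_mem b s
  have h2 : bSeq b (mIdx b s) = ⊥ := h0
  simp [h2] at h1

theorem aux_s_real (b : Fin nb → ℝ) (s : Fin ns → ℝ) (h : 2 ≤ mIdx b s) :
    ∃ p : ℝ, auxS s (mIdx b s) = p := by
  apply auxS_real _ _ (by omega)
  intro h0
  have h1 := aux_mem b s
  have h2 : sSeq s (mIdx b s) = min 0 ⊥ := congrArg (min 0) h0
  simp [h2] at h1

theorem aux_buyer_price (b : Fin nb → ℝ) (s : Fin ns → ℝ) (p : ℝ)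
    (h : auxS b (mIdx b s) = p) : buyerPrice b s = p := by
  have h2 : bSeq b (mIdx b s) = p := h
  simp [buyerPrice, h2]

theorem aux_seller_price (b : Fin nb → ℝ) (s : Fin ns → ℝ) (p : ℝ)
    (h : auxS s (mIdx b s) = p) : sellerPrice b s = min 0 p := by
  have h2 : sSeq s (mIdx b s) = min 0 (p : EReal) := congrArg (min 0) h
  have h3 : min 0 (p : EReal) = ((min 0 p : ℝ) : EReal) := by
    rcases le_total 0 p with h | h
    · rw [min_eq_left h, min_eq_left (by exact_mod_cast h)]; rfl
    · rw [min_eq_right h, min_eq_right (by exact_mod_cast h)]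
  rw [sellerPrice, h2, h3, EReal.toReal_coe]

theorem aux_buyer_ir (b : Fin nb → ℝ) (s : Fin ns → ℝ) (i : Fin nb) :
    0 ≤ buyerUtil b s i (b i) := by
  unfold buyerUtil
  split_ifs with h
  · obtain ⟨p, hp⟩ := aux_b_real b s h.1
    rw [aux_buyer_price b s p hp]
    have := auxS_le b i _ h.2
    rw [hp] at this
    have : p ≤ b i := by exact_mod_cast this
    linarith
  · exact le_rfl

theorem aux_seller_ir (b : Fin nb → ℝ) (s : Fin ns → ℝ) (i : Fin ns) :
    0 ≤ sellerUtil b s i (s i) := by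
  unfold sellerUtil
  split_ifs with h
  · obtain ⟨p, hp⟩ := aux_s_real b s h.1
    rw [aux_seller_price b s p hp]
    have := auxS_le s i _ h.2
    rw [hp] at this
    have : p ≤ s i := by exact_mod_cast this
    have := min_le_right 0 p
    linarith
  · exact le_rfl

theorem aux_buyer (b : Fin nb → ℝ) (s : Fin ns → ℝ) (i : Fin nb) (w v : ℝ) :
    buyerUtil (Function.update b i v) s i w ≤ buyerUtil (Function.update b i w) s i w := by
  have hir := aux_buyer_ir (Function.update b i w) s i
  rw [Function.update_self] at hir
  by_cases h : buyerTrades (Function.update b i v) s i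
  · obtain ⟨p, hp⟩ := aux_b_real _ s h.1
    have hu : buyerUtil (Function.update b i v) s i w = w - p := by
      rw [buyerUtil, if_pos h, aux_buyer_price _ s p hp]
    rw [hu]
    by_cases hw : p < w
    · obtain ⟨hr, hS⟩ := aux_core b i v w p _ h.2 hp hw
      have hm : mIdx (Function.update b i w) s = mIdx (Function.update b i v) s :=
        aux_mIdx_eq _ _ _ _ hS (fun _ _ => rfl)
      have ht : buyerTrades (Function.update b i w) s i := by
        refine ⟨?_, ?_⟩
        · rw [hm]; exact h.1
        · rw [hm]; exact hr
      rw [buyerUtil, if_pos ht, aux_buyer_price _ s p]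
      rw [hm, hS _ le_rfl, hp]
    · linarith
  · rw [buyerUtil, if_neg h]
    exact hir

theorem aux_seller (b : Fin nb → ℝ) (s : Fin ns → ℝ) (i : Fin ns) (w v : ℝ) (hw0 : w ≤ 0) :
    sellerUtil b (Function.update s i v) i w ≤ sellerUtil b (Function.update s i w) i w := by
  have hir := aux_seller_ir b (Function.update s i w) i
  rw [Function.update_self] at hir
  by_cases h : sellerTrades b (Function.update s i v) i
  · obtain ⟨p, hp⟩ := aux_s_real b _ h.1
    have hu : sellerUtil b (Function.update s i v) i w = w - min 0 p := by
      rw [sellerUtil, if_pos h, aux_seller_price b _ p hp]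
    rw [hu]
    by_cases hw : p < w
    · obtain ⟨hr, hS⟩ := aux_core s i v w p _ h.2 hp hw
      have hm : mIdx b (Function.update s i w) = mIdx b (Function.update s i v) :=
        aux_mIdx_eq _ _ _ _ (fun _ _ => rfl) (fun k hk => congrArg (min 0) (hS k hk))
      have ht : sellerTrades b (Function.update s i w) i := by
        refine ⟨?_, ?_⟩
        · rw [hm]; exact h.1
        · rw [hm]; exact hr
      rw [sellerUtil, if_pos ht, aux_seller_price b _ p]
      rw [hm, hS _ le_rfl, hp]
    · have : w ≤ min 0 p := le_min hw0 (not_lt.mp hw)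
      linarith
  · rw [sellerUtil, if_neg h]
    exact hir

/-- **Truthfulness of the static trade-reduction DA**: whatever the reports of the
other agents, no buyer (value `> 0`) and no seller (value `≤ 0`) can strictly increase
its utility by reporting a value different from its true value. -/
theorem trda_truthful :
    (∀ (nb ns : ℕ) (b : Fin nb → ℝ) (s : Fin ns → ℝ),
      (∀ j, 0 < b j) → (∀ j, s j ≤ 0) →
      ∀ (i : Fin nb) (w v : ℝ), 0 < w → 0 < v →
        buyerUtil (Function.update b i v) s i w ≤
          buyerUtil (Function.update b i w) s i w) ∧
    (∀ (nb ns : ℕ) (b : Fin nb → ℝ) (s : Fin ns → ℝ),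
      (∀ j, 0 < b j) → (∀ j, s j ≤ 0) →
      ∀ (j : Fin ns) (w v : ℝ), w ≤ 0 → v ≤ 0 →
        sellerUtil b (Function.update s j v) j w ≤
          sellerUtil b (Function.update s j w) j w) := by
  exact ⟨fun nb ns b s _ _ i w v _ _ => aux_buyer b s i w v,
    fun nb ns b s _ _ j w v hw _ => aux_seller b s j w v hw⟩

end TRDA
end
end

section
/- The construction SNT^t := NT^t is not a valid strong no-trade construction for the trade-reduction (tr-DA) matching rule: there exists an order book of bids and asks, all with reported departure later than t, for which validity condition (b) fails — some agent's alternate value report changes which other non-departing agents belong to NT^t. -/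
/-!
STATEMENT 4: The construction `SNT^t := NT^t` is NOT a valid strong no-trade
construction for the trade-reduction (tr-DA) matching rule: there is an order book of
bids and asks, all with reported departure later than `t`, for which condition (b)
fails: some agent's alternate value report changes which other non-departing agents
belong to `NT^t`.
-/

open Finset

attribute [local instance] Classical.propDecidable

noncomputable section

namespace TRDASnt

variable {nb ns : ℕ}

/-- `k`-th entry of the descending sequence of the values of the bids present in `B`
(dummy `+∞` at index 0, `⊥` past the real bids). -/
def bSeq (B : Finset (Fin nb)) (b : Fin nb → ℝ) (k : ℕ) : EReal :=
  sSup {x : EReal | k ≤ (B.filter fun j => x ≤ (b j : EReal)).card}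

/-- `k`-th entry of the descending sequence of the values of the asks present in `S`
(dummy `0` at index 0, `⊥` past the real asks). -/
def sSeq (S : Finset (Fin ns)) (s : Fin ns → ℝ) (k : ℕ) : EReal :=
  min 0 (sSup {x : EReal | k ≤ (S.filter fun j => x ≤ (s j : EReal)).card})

/-- Index of the last efficiently-clearing bid–ask pair. -/
def mIdx (B : Finset (Fin nb)) (S : Finset (Fin ns)) (b : Fin nb → ℝ)
    (s : Fin ns → ℝ) : ℕ :=
  sSup {k : ℕ | 0 ≤ bSeq B b k + sSeq S s k}

/-- Rank of bid `i` among the bids present in `B` (ties broken by index). -/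
def rankB (B : Finset (Fin nb)) (b : Fin nb → ℝ) (i : Fin nb) : ℕ :=
  1 + (B.filter fun j => b i < b j ∨ (b j = b i ∧ j < i)).card

/-- Rank of ask `j` among the asks present in `S`. -/
def rankS (S : Finset (Fin ns)) (s : Fin ns → ℝ) (j : Fin ns) : ℕ :=
  1 + (S.filter fun k => s j < s k ∨ (s k = s j ∧ k < j)).card

/-- Buyer `i` trades in the trade-reduction DA applied to `(B, S)`. -/
def buyerTrades (B : Finset (Fin nb)) (S : Finset (Fin ns)) (b : Fin nb → ℝ)
    (s : Fin ns → ℝ) (i : Fin nb) : Prop :=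
  i ∈ B ∧ 2 ≤ mIdx B S b s ∧ rankB B b i < mIdx B S b s

/-- Seller `j` trades in the trade-reduction DA applied to `(B, S)`. -/
def sellerTrades (B : Finset (Fin nb)) (S : Finset (Fin ns)) (b : Fin nb → ℝ)
    (s : Fin ns → ℝ) (j : Fin ns) : Prop :=
  j ∈ S ∧ 2 ≤ mIdx B S b s ∧ rankS S s j < mIdx B S b s

/-- A single-period market: the present bids and asks, their reported values and
their reported departures. -/
structure Market (nb ns : ℕ) where
  B : Finset (Fin nb)
  S : Finset (Fin ns)
  bv : Fin nb → ℝ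
  sv : Fin ns → ℝ
  bd : Fin nb → ℕ
  sd : Fin ns → ℕ

/-- An agent is either a bid or an ask. -/
abbrev Agent (nb ns : ℕ) := Fin nb ⊕ Fin ns

/-- The agent is present in the market. -/
def present (M : Market nb ns) : Agent nb ns → Prop
  | .inl i => i ∈ M.B
  | .inr j => j ∈ M.S

/-- Reported departure of an agent. -/
def dep (M : Market nb ns) : Agent nb ns → ℕ
  | .inl i => M.bd i
  | .inr j => M.sd j

/-- Sign constraint on a replacement value: positive for bids, nonpositive for asks. -/
def signOK : Agent nb ns → ℝ → Prop
  | .inl _, v => 0 < v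
  | .inr _, v => v ≤ 0

/-- Present bids have positive values and present asks nonpositive values. -/
def signValid (M : Market nb ns) : Prop :=
  (∀ i ∈ M.B, 0 < M.bv i) ∧ (∀ j ∈ M.S, M.sv j ≤ 0)

/-- The market after agent `x` changes its report to value `v` and departure `d`. -/
def updateReport (M : Market nb ns) : Agent nb ns → ℝ → ℕ → Market nb ns
  | .inl i, v, d =>
      { M with bv := Function.update M.bv i v, bd := Function.update M.bd i d }
  | .inr j, v, d =>
      { M with sv := Function.update M.sv j v, sd := Function.update M.sd j d }

/-- The market with agent `x` absent. -/
def eraseAgent (M : Market nb ns) : Agent nb ns → Market nb ns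
  | .inl i => { M with B := M.B.erase i }
  | .inr j => { M with S := M.S.erase j }

/-- Agent `x` trades in the trade-reduction DA applied to market `M`. -/
def trades (M : Market nb ns) : Agent nb ns → Prop
  | .inl i => buyerTrades M.B M.S M.bv M.sv i
  | .inr j => sellerTrades M.B M.S M.bv M.sv j

/-- `NT`: the present agents for which no trade is possible at any (sign-respecting)
replacement value. -/
def NT (M : Market nb ns) : Set (Agent nb ns) :=
  {x | present M x ∧ ∀ v : ℝ, signOK x v → ¬ trades (updateReport M x v (dep M x)) x}

/-- The agents other than `x` that a construction `F` designates as strong no-trade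
and that do not depart in period `t`. -/
def othersSNT (F : Market nb ns → Set (Agent nb ns)) (t : ℕ) (M : Market nb ns)
    (x : Agent nb ns) : Set (Agent nb ns) :=
  {y | y ∈ F M ∧ y ≠ x ∧ t < dep M y}

/-- Validity of a strong no-trade construction `F` in period `t`:
`F M ⊆ NT M`, condition (a) (membership of a non-departing no-trade agent in `F M` is
unchanged by its own alternate reports with departure after `t`), and condition (b)
(for a non-departing agent of `F M`, the set of other non-departing agents of `F M` is
unchanged by its alternate reports with departure after `t`, and even by its absence
from the market). -/
def ValidSNT (t : ℕ) (F : Market nb ns → Set (Agent nb ns)) : Prop :=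
  ∀ M : Market nb ns, signValid M →
    (F M ⊆ NT M) ∧
    (∀ x ∈ NT M, t < dep M x →
      ∀ (v : ℝ) (d' : ℕ), signOK x v → t < d' →
        (x ∈ F M ↔ x ∈ F (updateReport M x v d'))) ∧
    (∀ x ∈ F M, t < dep M x →
      ∀ (v : ℝ) (d' : ℕ), signOK x v → t < d' →
        othersSNT F t (updateReport M x v d') x = othersSNT F t M x ∧
          othersSNT F t (eraseAgent M x) x = othersSNT F t M x)


theorem aux_card {p : Fin 2 → Prop} {k : ℕ} (hk : 2 ≤ k)
    (h : k ≤ (Finset.univ.filter p).card) (i : Fin 2) : p i := by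
  have h2 : (Finset.univ : Finset (Fin 2)).card ≤ (Finset.univ.filter p).card := by
    simpa using hk.trans h
  have h3 := Finset.eq_of_subset_of_card_le (Finset.filter_subset p Finset.univ) h2
  have h4 : i ∈ Finset.univ.filter p := by rw [h3]; simp
  exact (Finset.mem_filter.1 h4).2

theorem aux_le (b s : Fin 2 → ℝ) (i j : Fin 2) (h : b i + s j < 0) :
    mIdx Finset.univ Finset.univ b s ≤ 1 := by
  apply csSup_le'
  intro k hk
  by_contra hlt
  have hk2 : 2 ≤ k := by omega
  have h1 : bSeq Finset.univ b k ≤ (b i : EReal) :=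
    sSup_le fun x hx => aux_card hk2 hx i
  have h2 : sSeq Finset.univ s k ≤ (s j : EReal) :=
    (min_le_right _ _).trans (sSup_le fun x hx => aux_card hk2 hx j)
  have h3 : (0 : EReal) ≤ ((b i + s j : ℝ) : EReal) := by
    rw [EReal.coe_add]
    exact le_trans hk (add_le_add h1 h2)
  have h4 : (0 : ℝ) ≤ b i + s j := by exact_mod_cast h3
  linarith

theorem aux_ge (b s : Fin 2 → ℝ) (c d : ℝ) (hb : ∀ i, c ≤ b i) (hs : ∀ i, d ≤ s i)
    (hd : d ≤ 0) (h : 0 ≤ c + d) : 2 ≤ mIdx Finset.univ Finset.univ b s := by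
  apply le_csSup
  · refine ⟨2, fun k hk => ?_⟩
    by_contra hlt
    have h1 : bSeq Finset.univ b k = ⊥ := by
      refine le_bot_iff.1 (sSup_le fun x hx => ?_)
      have h5 : k ≤ (Finset.univ.filter fun j => x ≤ (b j : EReal)).card := hx
      have h6 := Finset.card_le_univ (Finset.univ.filter fun j => x ≤ (b j : EReal))
      simp only [Fintype.card_fin] at h6
      omega
    have hk' : (0 : EReal) ≤ bSeq Finset.univ b k + sSeq Finset.univ s k := hk
    rw [h1, EReal.bot_add] at hk'
    simp at hk'
  · have h1 : (c : EReal) ≤ bSeq Finset.univ b 2 := by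
      apply le_sSup
      have : (Finset.univ.filter fun j => (c : EReal) ≤ (b j : EReal)) = Finset.univ :=
        Finset.filter_true_of_mem fun j _ => by exact_mod_cast hb j
      simp only [Set.mem_ofPred_eq]
      rw [this]; simp
    have h2 : (d : EReal) ≤ sSeq Finset.univ s 2 := by
      apply le_min
      · exact_mod_cast hd
      apply le_sSup
      have : (Finset.univ.filter fun j => (d : EReal) ≤ (s j : EReal)) = Finset.univ :=
        Finset.filter_true_of_mem fun j _ => by exact_mod_cast hs j
      simp only [Set.mem_ofPred_eq]
      rw [this]; simp
    have h3 : (0 : EReal) ≤ ((c + d : ℝ) : EReal) := by exact_mod_cast h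
    rw [EReal.coe_add] at h3
    exact h3.trans (add_le_add h1 h2)

def exM : Market 2 2 :=
  ⟨Finset.univ, Finset.univ, fun _ => 3, ![-1, -5], fun _ => 1, fun _ => 1⟩

theorem exM_sign : signValid exM := by
  refine ⟨fun i _ => by simp [exM], fun j _ => ?_⟩
  fin_cases j <;> simp [exM]

theorem exM_dep (x : Agent 2 2) : 0 < dep exM x := by
  rcases x with i | i <;> simp [exM, dep]

theorem exM_x : (Sum.inl 0 : Agent 2 2) ∈ NT exM := by
  refine ⟨Finset.mem_univ _, fun v _ ht => ?_⟩
  have h := aux_le (Function.update exM.bv 0 v) exM.sv 1 1 (by simp [exM]; norm_num)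
  have h2 : 2 ≤ mIdx Finset.univ Finset.univ (Function.update exM.bv 0 v) exM.sv := ht.2.1
  omega

theorem exM_y : (Sum.inr 1 : Agent 2 2) ∉ NT exM := by
  intro hn
  apply hn.2 0 (le_refl (0 : ℝ))
  have h := aux_ge exM.bv (Function.update exM.sv 1 0) 3 (-1) (fun i => by simp [exM])
    (fun i => by fin_cases i <;> simp [exM]) (by norm_num) (by norm_num)
  refine ⟨Finset.mem_univ _, h, lt_of_lt_of_le ?_ h⟩
  have : rankS Finset.univ (Function.update exM.sv 1 0) 1 = 1 := by
    unfold rankS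
    rw [Finset.filter_false_of_mem]
    · simp
    · intro k _
      fin_cases k <;> simp [exM]
  change rankS Finset.univ (Function.update exM.sv 1 0) 1 < 2
  omega

theorem exM_y' : (Sum.inr 1 : Agent 2 2) ∈ NT (updateReport exM (Sum.inl 0) (1/2) 1) := by
  refine ⟨Finset.mem_univ _, fun v _ ht => ?_⟩
  have h := aux_le (Function.update exM.bv 0 (1/2)) (Function.update exM.sv 1 v) 0 0
    (by simp [exM]; norm_num)
  have h2 : 2 ≤ mIdx Finset.univ Finset.univ (Function.update exM.bv 0 (1/2))
    (Function.update exM.sv 1 v) := ht.2.1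
  omega

theorem exM_ne : othersSNT (fun M' => NT M') 0 (updateReport exM (Sum.inl 0) (1/2) 1)
    (Sum.inl 0) ≠ othersSNT (fun M' => NT M') 0 exM (Sum.inl 0) := by
  intro h
  have h1 : (Sum.inr 1 : Agent 2 2) ∈ othersSNT (fun M' => NT M') 0
      (updateReport exM (Sum.inl 0) (1/2) 1) (Sum.inl 0) :=
    ⟨exM_y', by simp, by simp [dep, updateReport, exM]⟩
  rw [h] at h1
  exact exM_y h1.1

/-- **`SNT^t := NT^t` is not a valid strong no-trade construction for tr-DA.** -/
theorem snt_eq_nt_invalid :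
    ∃ (nb ns t : ℕ), ¬ ValidSNT t (fun M : Market nb ns => NT M) ∧
      ∃ M : Market nb ns, signValid M ∧ (∀ x, present M x → t < dep M x) ∧
        ∃ x ∈ NT M, ∃ (v : ℝ) (d' : ℕ), signOK x v ∧ t < d' ∧
          othersSNT (fun M' => NT M') t (updateReport M x v d') x ≠
            othersSNT (fun M' => NT M') t M x := by
  have hv : (0 : ℝ) < 1 / 2 := by norm_num
  refine ⟨2, 2, 0, fun hV => ?_, exM, exM_sign, fun x _ => exM_dep x, Sum.inl 0, exM_x,
    1 / 2, 1, hv, Nat.one_pos, exM_ne⟩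
  exact exM_ne ((hV exM exM_sign).2.2 _ exM_x (exM_dep _) (1 / 2) 1 hv Nat.one_pos).1

end TRDASnt
end
end

section
/- No strongly truthful, individual-rational, no-deficit, feasible, anonymous dynamic DA can be reasonable in the simple high/low-valued-phase environment when a bidder's patience can be unbounded: for every parameterization N≥1 and L≥1, there exist choices of v_H>v_L>0, bid-spread ε>0, mark-up α>1, high patience d̄, and number of high-valued phases T_h such that the DA fails to execute a trade between new bids and new asks in some phase. -/
/-!
STATEMENT 18: No strongly truthful, individual-rational, no-deficit, feasible,
anonymous dynamic DA can be reasonable in the simple high/low-valued-phase environment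
when a bidder's patience can be unbounded: for every parameterization `N ≥ 1`, `L ≥ 1`
there exist `v_H > v_L > 0`, bid-spread `ε > 0`, mark-up `α > 1`, high patience `d̄`,
and a number of high-valued phases `T_h` for which the DA fails to execute a trade
between new bids and new asks in some phase.

A dynamic DA is modelled, following the paper, by per-period trade probabilities
`π_i^t(θ^{≤t}) ∈ [0,1]` and per-period (expected) payments `x_i^t(θ^{≤t}) ∈ ℝ`.
-/

open Finset

attribute [local instance] Classical.propDecidable

noncomputable section

namespace UnboundedPatience

/-- An agent type/report: arrival, departure, value (positive: buyer; nonpositive: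
seller). -/
structure AgentType where
  a : ℕ
  d : ℕ
  w : ℝ

/-- A dynamic DA: for each finite set of participants `P` and report profile `θ`, a
trade probability `prob P θ i t` and a payment `pay P θ i t` for agent `i` in period
`t`. -/
structure DynDA where
  prob : Finset ℕ → (ℕ → AgentType) → ℕ → ℕ → ℝ
  pay : Finset ℕ → (ℕ → AgentType) → ℕ → ℕ → ℝ

/-- The last reported departure of a participant. -/
def horizon (P : Finset ℕ) (θ : ℕ → AgentType) : ℕ := P.sup fun i => (θ i).d

/-- Well-formedness of a dynamic DA: probabilities lie in `[0,1]`; each agent trades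
at most once; non-participants and periods outside the reported interval get zero
probability and zero payment; and period-`t` quantities depend only on the reports
with arrival at most `t` (the DA is online). -/
def IsDynDA (D : DynDA) : Prop :=
  (∀ P θ i t, 0 ≤ D.prob P θ i t ∧ D.prob P θ i t ≤ 1) ∧
  (∀ P θ i, (∑ t ∈ Finset.Icc 1 (horizon P θ), D.prob P θ i t) ≤ 1) ∧
  (∀ P θ i t, (i ∉ P ∨ t < (θ i).a ∨ (θ i).d < t) →
    D.prob P θ i t = 0 ∧ D.pay P θ i t = 0) ∧
  (∀ P (θ θ' : ℕ → AgentType) (i t : ℕ),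
    (∀ j ∈ P, (θ j).a ≤ t → θ j = θ' j) → (∀ j ∈ P, (θ' j).a ≤ t → θ j = θ' j) →
    D.prob P θ i t = D.prob P θ' i t ∧ D.pay P θ i t = D.pay P θ' i t)

/-- Value enjoyed by an agent with true type `T` when it trades in period `t`: a buyer
values the trade only inside its true interval; a seller incurs its cost in any case. -/
def tradeVal (T : AgentType) (t : ℕ) : ℝ :=
  if 0 < T.w then (if T.a ≤ t ∧ t ≤ T.d then T.w else 0) else T.w

/-- Expected utility of agent `i` with true type `T`, under the reported profile. -/
def util (D : DynDA) (P : Finset ℕ) (θ : ℕ → AgentType) (i : ℕ) (T : AgentType) :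
    ℝ :=
  ∑ t ∈ Finset.Icc 1 (horizon P θ),
    (D.prob P θ i t * tradeVal T t - D.pay P θ i t)

/-- Strong truthfulness with misreports limited to no early arrivals: reporting the
true type dominates any misreport with a later arrival on the same market side. -/
def Truthful (D : DynDA) : Prop :=
  ∀ (P : Finset ℕ) (θ : ℕ → AgentType) (i : ℕ) (T r : AgentType), i ∈ P →
    T.a ≤ T.d → T.a ≤ r.a → r.a ≤ r.d → (0 < r.w ↔ 0 < T.w) →
    util D P (Function.update θ i r) i T ≤ util D P (Function.update θ i T) i T

/-- Individual rationality: a truthful agent's utility is nonnegative. -/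
def IR (D : DynDA) : Prop := ∀ P θ i, i ∈ P → 0 ≤ util D P θ i (θ i)

/-- No-deficit: cumulative payments collected are nonnegative in every period. -/
def NoDeficit (D : DynDA) : Prop :=
  ∀ P θ t, 0 ≤ ∑ i ∈ P, ∑ t' ∈ Finset.Icc 1 t, D.pay P θ i t'

/-- Feasibility: in every period, the cumulative (expected) number of sellers matched
is at least the cumulative number of buyers matched. -/
def Feasible (D : DynDA) : Prop :=
  ∀ P θ t,
    (∑ i ∈ P.filter fun i => 0 < (θ i).w, ∑ t' ∈ Finset.Icc 1 t, D.prob P θ i t') ≤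
      ∑ i ∈ P.filter fun i => ¬ 0 < (θ i).w, ∑ t' ∈ Finset.Icc 1 t, D.prob P θ i t'

/-- Anonymity: the trade probability and the payment of an agent are independent of
its identity and invariant to permutations of the other agents' reports. -/
def Anonymous (D : DynDA) : Prop :=
  ∀ (P : Finset ℕ) (θ : ℕ → AgentType) (g : Equiv.Perm ℕ) (i t : ℕ),
    D.prob (P.image g) (θ ∘ g.symm) (g i) t = D.prob P θ i t ∧
      D.pay (P.image g) (θ ∘ g.symm) (g i) t = D.pay P θ i t

/-- An instance of the simple environment with parameters `N, L`, `T_h` high-valued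
phases, `nLow` low-valued phases, values `v_H > v_L`, bid-spread `ε`, mark-up `α`, and
high patience `d̄`: each high-valued phase `k < T_h` contains `N` or `N-1` bids of type
`(1+kL, (k+1)L, v_H)`, at most one patient bid of type `(1+kL, d̄, α v_H)`, and `N`
asks of type `(1+kL, (k+1)L, -(v_H-ε))`; each low-valued phase contains `N` or `N-1`
bids of type `(1+kL, (k+1)L, v_L)` and `N` asks of type `(1+kL, (k+1)L, -(v_L-ε))`;
and there are no other participants. -/
def IsEnvInstance (N L Th nLow : ℕ) (vH vL ε α : ℝ) (dbar : ℕ)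
    (P : Finset ℕ) (θ : ℕ → AgentType) : Prop :=
  (∀ i ∈ P,
    (∃ k < Th,
      θ i = ⟨1 + k * L, (k + 1) * L, vH⟩ ∨ θ i = ⟨1 + k * L, dbar, α * vH⟩ ∨
        θ i = ⟨1 + k * L, (k + 1) * L, -(vH - ε)⟩) ∨
    (∃ k, Th ≤ k ∧ k < Th + nLow ∧
      (θ i = ⟨1 + k * L, (k + 1) * L, vL⟩ ∨
        θ i = ⟨1 + k * L, (k + 1) * L, -(vL - ε)⟩))) ∧
  (∀ k < Th,
    ((P.filter fun i => θ i = ⟨1 + k * L, (k + 1) * L, vH⟩).card = N ∨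
      (P.filter fun i => θ i = ⟨1 + k * L, (k + 1) * L, vH⟩).card = N - 1) ∧
    (P.filter fun i => θ i = ⟨1 + k * L, dbar, α * vH⟩).card ≤ 1 ∧
    (P.filter fun i => θ i = ⟨1 + k * L, (k + 1) * L, -(vH - ε)⟩).card = N) ∧
  (∀ k, Th ≤ k → k < Th + nLow →
    ((P.filter fun i => θ i = ⟨1 + k * L, (k + 1) * L, vL⟩).card = N ∨
      (P.filter fun i => θ i = ⟨1 + k * L, (k + 1) * L, vL⟩).card = N - 1) ∧
    (P.filter fun i => θ i = ⟨1 + k * L, (k + 1) * L, -(vL - ε)⟩).card = N)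

/-- Reasonableness: for SOME parameterization `N ≥ 1`, `L ≥ 1`, the DA executes at
least one trade between the new bids and the new asks of each phase (in expectation),
for ANY number of phases and ANY choice of `v_H`, `v_L < v_H`, `ε > 0`, `α > 1` and
high patience `d̄`. -/
def Reasonable (D : DynDA) : Prop :=
  ∃ N, 1 ≤ N ∧ ∃ L, 1 ≤ L ∧
    ∀ (Th nLow : ℕ) (vH vL ε α : ℝ) (dbar : ℕ) (P : Finset ℕ) (θ : ℕ → AgentType),
      1 ≤ Th → 0 < vL → vL < vH → 0 < ε → ε < vL → 1 < α →
      IsEnvInstance N L Th nLow vH vL ε α dbar P θ →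
      ∀ k < Th + nLow,
        (1 ≤ ∑ i ∈ P.filter fun i => (θ i).a = 1 + k * L ∧ 0 < (θ i).w,
              ∑ t ∈ Finset.Icc 1 (horizon P θ), D.prob P θ i t) ∧
        (1 ≤ ∑ i ∈ P.filter fun i => (θ i).a = 1 + k * L ∧ ¬ 0 < (θ i).w,
              ∑ t ∈ Finset.Icc 1 (horizon P θ), D.prob P θ i t)

/-- Total trade probability of an agent. -/
def totP (D : DynDA) (P : Finset ℕ) (θ : ℕ → AgentType) (i : ℕ) : ℝ :=
  ∑ t ∈ Finset.Icc 1 (horizon P θ), D.prob P θ i t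

/-- Total payment of an agent. -/
def totX (D : DynDA) (P : Finset ℕ) (θ : ℕ → AgentType) (i : ℕ) : ℝ :=
  ∑ t ∈ Finset.Icc 1 (horizon P θ), D.pay P θ i t

lemma util_eq (D : DynDA) (hD : IsDynDA D) (P : Finset ℕ) (θ : ℕ → AgentType) (i : ℕ)
    (T : AgentType) (h1 : T.a ≤ (θ i).a) (h2 : (θ i).d ≤ T.d) :
    util D P θ i T = totP D P θ i * T.w - totX D P θ i := by
  unfold util totP totX
  rw [Finset.sum_sub_distrib, Finset.sum_mul]
  congr 1
  apply Finset.sum_congr rfl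
  intro t _
  by_cases ht : t < (θ i).a ∨ (θ i).d < t
  · rw [(hD.2.2.1 P θ i t (Or.inr ht)).1]; simp
  · push Not at ht
    congr 1
    unfold tradeVal
    rw [if_pos (⟨h1.trans ht.1, ht.2.trans h2⟩ : T.a ≤ t ∧ t ≤ T.d)]
    simp

lemma totP_nonneg (D : DynDA) (hD : IsDynDA D) (P : Finset ℕ) (θ : ℕ → AgentType) (i : ℕ) :
    0 ≤ totP D P θ i := Finset.sum_nonneg fun t _ => (hD.1 P θ i t).1

lemma sum_util_le (D : DynDA) (hD : IsDynDA D) (hnd : NoDeficit D) (hfe : Feasible D)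
    (P : Finset ℕ) (θ : ℕ → AgentType) (B : ℝ) (hB : 0 ≤ B)
    (hw : ∀ i ∈ P, (θ i).w ≤ B) :
    ∑ i ∈ P, util D P θ i (θ i) ≤
      ∑ i ∈ P.filter (fun i => ¬ 0 < (θ i).w), totP D P θ i * (B + (θ i).w) := by
  have e : ∑ i ∈ P, util D P θ i (θ i) =
      ∑ i ∈ P, totP D P θ i * (θ i).w - ∑ i ∈ P, totX D P θ i := by
    rw [← Finset.sum_sub_distrib]
    exact Finset.sum_congr rfl fun i _ => util_eq D hD P θ i (θ i) le_rfl le_rfl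
  have h1 : 0 ≤ ∑ i ∈ P, totX D P θ i := hnd P θ (horizon P θ)
  have h2 : ∑ i ∈ P.filter (fun i => 0 < (θ i).w), totP D P θ i ≤
    ∑ i ∈ P.filter (fun i => ¬ 0 < (θ i).w), totP D P θ i := hfe P θ (horizon P θ)
  have h3 : ∑ i ∈ P, totP D P θ i * (θ i).w =
      ∑ i ∈ P.filter (fun i => 0 < (θ i).w), totP D P θ i * (θ i).w +
      ∑ i ∈ P.filter (fun i => ¬ 0 < (θ i).w), totP D P θ i * (θ i).w :=
    (Finset.sum_filter_add_sum_filter_not _ _ _).symm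
  have h4 : ∑ i ∈ P.filter (fun i => 0 < (θ i).w), totP D P θ i * (θ i).w ≤
      ∑ i ∈ P.filter (fun i => 0 < (θ i).w), totP D P θ i * B :=
    Finset.sum_le_sum fun i hi => mul_le_mul_of_nonneg_left
      (hw i (Finset.mem_filter.1 hi).1) (totP_nonneg D hD P θ i)
  rw [← Finset.sum_mul] at h4
  have h5 := mul_le_mul_of_nonneg_right h2 hB
  have h6 : ∑ i ∈ P.filter (fun i => ¬ 0 < (θ i).w), totP D P θ i * (B + (θ i).w) =
     (∑ i ∈ P.filter (fun i => ¬ 0 < (θ i).w), totP D P θ i) * B +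
     ∑ i ∈ P.filter (fun i => ¬ 0 < (θ i).w), totP D P θ i * (θ i).w := by
    rw [Finset.sum_mul, ← Finset.sum_add_distrib]
    exact Finset.sum_congr rfl fun i _ => by ring
  rw [e, h3, h6]
  linarith

lemma totP_symm (D : DynDA) (han : Anonymous D) (P : Finset ℕ) (θ : ℕ → AgentType)
    (i j : ℕ) (hi : i ∈ P) (hj : j ∈ P) (h : θ i = θ j) :
    totP D P θ j = totP D P θ i := by
  unfold totP
  apply Finset.sum_congr rfl
  intro t _
  have := (han P θ (Equiv.swap i j) i t).1
  have hP : P.image (Equiv.swap i j) = P := by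
    apply Finset.eq_of_subset_of_card_le
    · intro x hx
      obtain ⟨y, hy, rfl⟩ := Finset.mem_image.1 hx
      rw [Equiv.swap_apply_def]
      split_ifs <;> assumption
    · rw [Finset.card_image_of_injective _ (Equiv.swap i j).injective]
  have hθ : θ ∘ (Equiv.swap i j).symm = θ := by
    funext x
    simp only [Function.comp, Equiv.symm_swap]
    rw [Equiv.swap_apply_def]
    split_ifs with h1 h2
    · rw [h1, h]
    · rw [h2, h]
    · rfl
  rw [hP, hθ, Equiv.swap_apply_left] at this
  exact this

/-- The profile. -/
def prof (N L Th : ℕ) (ε : ℝ) (i : ℕ) : AgentType :=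
  if i % (2 * N) < N - 1 then
    ⟨1 + i / (2 * N) * L, (i / (2 * N) + 1) * L, if i / (2 * N) < Th then 2 else 1⟩
  else if i % (2 * N) < 2 * N - 1 then
    ⟨1 + i / (2 * N) * L, (i / (2 * N) + 1) * L,
      -((if i / (2 * N) < Th then 2 else 1) - ε)⟩
  else ⟨1 + i / (2 * N) * L, (Th + 1) * L, (1 + ε / 2) * 2⟩

/-- The participants. -/
def parts (N Th : ℕ) : Finset ℕ := Finset.range (2 * N * (Th + 1) - 1)

lemma divmod_iff (M k c e i : ℕ) (he : e ≤ M) :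
    (i / M = k ∧ c ≤ i % M ∧ i % M < e) ↔ i ∈ Finset.Ico (M * k + c) (M * k + e) := by
  rw [Finset.mem_Ico]
  have hdm := Nat.div_add_mod i M
  constructor
  · rintro ⟨rfl, h1, h2⟩
    omega
  · rintro ⟨h1, h2⟩
    have hk : i / M = k := by
      rw [Nat.div_eq_iff (by omega)]
      rw [mul_comm k M]
      omega
    rw [hk] at hdm
    exact ⟨hk, by omega, by omega⟩

lemma mem_parts (N Th i : ℕ) (hN : 1 ≤ N) :
    i ∈ parts N Th ↔ (i / (2 * N) < Th ∨ (i / (2 * N) = Th ∧ i % (2 * N) < 2 * N - 1)) := by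
  have hdm := Nat.div_add_mod i (2 * N)
  have hm := Nat.mod_lt i (show 2 * N > 0 by omega)
  unfold parts
  rw [Finset.mem_range]
  rw [mul_add]
  constructor
  · intro h
    rcases lt_trichotomy (i / (2 * N)) Th with h1 | h1 | h1
    · exact Or.inl h1
    · rw [h1] at hdm; right; exact ⟨h1, by omega⟩
    · have := Nat.mul_le_mul_left (2 * N) (show Th + 1 ≤ i / (2 * N) from h1)
      rw [mul_add] at this
      omega
  · rintro (h | ⟨h, h'⟩)
    · have := Nat.mul_le_mul_left (2 * N) (show i / (2 * N) + 1 ≤ Th from h)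
      rw [mul_add] at this
      omega
    · rw [h] at hdm; omega

lemma arr_inj (L k k' : ℕ) (hL : 1 ≤ L) : 1 + k * L = 1 + k' * L ↔ k = k' := by
  constructor
  · intro h
    exact Nat.eq_of_mul_eq_mul_right hL (by omega)
  · rintro rfl; rfl

section env
variable (N L Th : ℕ) (ε : ℝ) (k₀ : ℕ)

/-- The deviated profile. -/
def dev : ℕ → AgentType :=
  Function.update (prof N L Th ε) (2 * N * k₀ + (2 * N - 1))
    ⟨1 + Th * L, (Th + 1) * L, 1⟩

lemma pat_divmod (hN : 1 ≤ N) (k : ℕ) : (2 * N * k + (2 * N - 1)) / (2 * N) = k ∧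
    (2 * N * k + (2 * N - 1)) % (2 * N) = 2 * N - 1 := by
  constructor
  · rw [Nat.mul_add_div (by omega), Nat.div_eq_of_lt (by omega)]; rfl
  · rw [Nat.mul_add_mod, Nat.mod_eq_of_lt (by omega)]

lemma dev_of_ne (i : ℕ) (h : i ≠ 2 * N * k₀ + (2 * N - 1)) :
    dev N L Th ε k₀ i = prof N L Th ε i := Function.update_of_ne h _ _

lemma dev_self : dev N L Th ε k₀ (2 * N * k₀ + (2 * N - 1)) = 
    ⟨1 + Th * L, (Th + 1) * L, 1⟩ := Function.update_self _ _ _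

lemma prof_arr (i : ℕ) : (prof N L Th ε i).a = 1 + i / (2 * N) * L := by
  unfold prof; split_ifs <;> rfl

lemma dev_env (hN : 1 ≤ N) (hL : 1 ≤ L) (hε : 0 < ε) (hε1 : ε < 1) (hk₀ : k₀ < Th) :
    IsEnvInstance N L Th 1 2 1 ε (1 + ε / 2) ((Th + 1) * L) (parts N Th)
      (dev N L Th ε k₀) := by
  have pd := pat_divmod N hN k₀
  have filt_card : ∀ k c e (T : AgentType), e ≤ 2 * N →
      (∀ i, (i ∈ parts N Th ∧ dev N L Th ε k₀ i = T) ↔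
        (i / (2 * N) = k ∧ c ≤ i % (2 * N) ∧ i % (2 * N) < e)) →
      ((parts N Th).filter fun i => dev N L Th ε k₀ i = T).card = e - c := by
    intro k c e T he h
    have : (parts N Th).filter (fun i => dev N L Th ε k₀ i = T) =
        Finset.Ico (2 * N * k + c) (2 * N * k + e) := by
      ext i
      rw [Finset.mem_filter, h, divmod_iff _ _ _ _ _ he]
    rw [this, Nat.card_Ico]; omega
  refine ⟨?_, ?_, ?_⟩
  · intro i hi
    rw [mem_parts N Th i hN] at hi
    by_cases hi0 : i = 2 * N * k₀ + (2 * N - 1)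
    · subst hi0
      rw [dev_self]
      exact Or.inr ⟨Th, le_rfl, by omega, Or.inl rfl⟩
    · rw [dev_of_ne _ _ _ _ _ _ hi0]
      rcases hi with hi | ⟨hi, hi'⟩
      · left
        refine ⟨i / (2 * N), hi, ?_⟩
        unfold prof
        rw [if_pos hi]
        split_ifs <;> simp
      · right
        refine ⟨i / (2 * N), hi.ge, by omega, ?_⟩
        unfold prof
        rw [if_neg (show ¬ i / (2 * N) < Th by omega), if_pos hi']
        split_ifs <;> simp
  · intro k hk
    refine ⟨Or.inr ?_, ?_, ?_⟩
    · rw [filt_card k 0 (N - 1) _ (by omega)]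
      · rfl
      intro i
      rw [mem_parts N Th i hN]
      by_cases hi0 : i = 2 * N * k₀ + (2 * N - 1)
      · subst hi0
        rw [dev_self, pd.1, pd.2]
        simp only [AgentType.mk.injEq]
        constructor
        · rintro ⟨_, _, _, h⟩; norm_num at h
        · rintro ⟨_, _, _⟩; omega
      · rw [dev_of_ne _ _ _ _ _ _ hi0]
        unfold prof
        split_ifs <;> simp only [AgentType.mk.injEq, arr_inj _ _ _ hL] <;> constructor <;>
          first
          | (rintro ⟨h1, h2, h3, h4⟩; first | (exfalso; linarith) | (exfalso; omega) | (refine ⟨?_, ?_, ?_⟩ <;> omega))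
          | (rintro ⟨h1, h2, h3⟩; first | (exfalso; omega) | (subst h1; refine ⟨by omega, rfl, rfl, trivial⟩))
    · apply Finset.card_le_one.2
      have key : ∀ a ∈ (parts N Th).filter (fun i => dev N L Th ε k₀ i =
          ⟨1 + k * L, (Th + 1) * L, (1 + ε / 2) * 2⟩), a = 2 * N * k + (2 * N - 1) := by
        intro i hi
        rw [Finset.mem_filter] at hi
        obtain ⟨_, hi⟩ := hi
        by_cases hi0 : i = 2 * N * k₀ + (2 * N - 1)
        · subst hi0
          rw [dev_self] at hi
          simp only [AgentType.mk.injEq] at hi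
          exfalso; linarith [hi.2.2]
        · rw [dev_of_ne _ _ _ _ _ _ hi0] at hi
          have hdm := Nat.div_add_mod i (2 * N)
          have hm := Nat.mod_lt i (show 2 * N > 0 by omega)
          unfold prof at hi
          split_ifs at hi <;> simp only [AgentType.mk.injEq, arr_inj _ _ _ hL] at hi <;>
            obtain ⟨h1, h2, h3⟩ := hi <;> 
            first | (exfalso; linarith) | (rw [h1] at hdm; omega)
      intro a ha b hb
      rw [key a ha, key b hb]
    · rw [filt_card k (N - 1) (2 * N - 1) _ (by omega)]
      · omega
      intro i
      rw [mem_parts N Th i hN]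
      by_cases hi0 : i = 2 * N * k₀ + (2 * N - 1)
      · subst hi0
        rw [dev_self, pd.1, pd.2]
        simp only [AgentType.mk.injEq]
        constructor
        · rintro ⟨_, _, _, h⟩; linarith
        · rintro ⟨_, _, _⟩; omega
      · rw [dev_of_ne _ _ _ _ _ _ hi0]
        unfold prof
        split_ifs <;> simp only [AgentType.mk.injEq, arr_inj _ _ _ hL] <;> constructor <;>
          first
          | (rintro ⟨h1, h2, h3, h4⟩; first | (exfalso; linarith) | (exfalso; omega) | (refine ⟨?_, ?_, ?_⟩ <;> omega))
          | (rintro ⟨h1, h2, h3⟩; first | (exfalso; omega) | (subst h1; refine ⟨by omega, rfl, rfl, trivial⟩))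
  · intro k hk hk'
    have hkT : k = Th := by omega
    subst hkT
    refine ⟨Or.inl ?_, ?_⟩
    · have : (parts N k).filter (fun i => dev N L k ε k₀ i = ⟨1 + k * L, (k + 1) * L, 1⟩) =
          insert (2 * N * k₀ + (2 * N - 1)) (Finset.Ico (2 * N * k + 0) (2 * N * k + (N - 1))) := by
        ext i
        rw [Finset.mem_filter, Finset.mem_insert, ← divmod_iff _ _ _ _ _ (by omega),
          mem_parts N k i hN]
        by_cases hi0 : i = 2 * N * k₀ + (2 * N - 1)
        · subst hi0
          rw [dev_self, pd.1, pd.2]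
          simp [hk₀]
        · rw [dev_of_ne _ _ _ _ _ _ hi0]
          simp only [hi0, false_or]
          unfold prof
          split_ifs <;> simp only [AgentType.mk.injEq, arr_inj _ _ _ hL] <;> constructor <;>
            first
            | (rintro ⟨h1, h2, h3, h4⟩; first | (exfalso; linarith) | (exfalso; omega) | (refine ⟨?_, ?_, ?_⟩ <;> omega))
            | (rintro ⟨h1, h2, h3⟩; first | (exfalso; omega) | (refine ⟨by omega, h1, by rw [h1], trivial⟩))
      rw [this, Finset.card_insert_of_notMem, Nat.card_Ico]
      · omega
      · rw [← divmod_iff _ _ _ _ _ (by omega), pd.1, pd.2]; omega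
    · rw [filt_card k (N - 1) (2 * N - 1) _ (by omega)]
      · omega
      intro i
      rw [mem_parts N k i hN]
      by_cases hi0 : i = 2 * N * k₀ + (2 * N - 1)
      · subst hi0
        rw [dev_self, pd.1, pd.2]
        simp only [AgentType.mk.injEq]
        constructor
        · rintro ⟨_, _, _, h⟩; linarith
        · rintro ⟨_, _, _⟩; omega
      · rw [dev_of_ne _ _ _ _ _ _ hi0]
        unfold prof
        split_ifs <;> simp only [AgentType.mk.injEq, arr_inj _ _ _ hL] <;> constructor <;>
          first
          | (rintro ⟨h1, h2, h3, h4⟩; first | (exfalso; linarith) | (exfalso; omega) | (refine ⟨?_, ?_, ?_⟩ <;> omega))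
          | (rintro ⟨h1, h2, h3⟩; first | (exfalso; omega) | (refine ⟨by omega, h1, by rw [h1], trivial⟩))

end env

lemma patient_util (D : DynDA) (hD : IsDynDA D)
    (htruth : Truthful D) (hIR : IR D) (han : Anonymous D) (N L Th : ℕ) (ε : ℝ) (k₀ : ℕ)
    (hN : 1 ≤ N) (hL : 1 ≤ L) (hε : 0 < ε) (hε1 : ε < 1) (hk₀ : k₀ < Th)
    (hreas : 1 ≤ ∑ i ∈ (parts N Th).filter fun i =>
        (dev N L Th ε k₀ i).a = 1 + Th * L ∧ 0 < (dev N L Th ε k₀ i).w,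
        totP D (parts N Th) (dev N L Th ε k₀) i) :
    1 / (N : ℝ) ≤ util D (parts N Th) (prof N L Th ε) (2 * N * k₀ + (2 * N - 1))
      (prof N L Th ε (2 * N * k₀ + (2 * N - 1))) := by
  have pd := pat_divmod N hN k₀
  have env := dev_env N L Th ε k₀ hN hL hε hε1 hk₀
  set i₀ := 2 * N * k₀ + (2 * N - 1) with hi₀
  have hi₀P : i₀ ∈ parts N Th := by
    rw [mem_parts N Th _ hN, pd.1]; exact Or.inl hk₀
  have hT : prof N L Th ε i₀ = ⟨1 + k₀ * L, (Th + 1) * L, (1 + ε / 2) * 2⟩ := by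
    unfold prof
    rw [pd.1, pd.2, if_neg (by omega), if_neg (by omega)]
  have hself : dev N L Th ε k₀ i₀ = ⟨1 + Th * L, (Th + 1) * L, 1⟩ := dev_self N L Th ε k₀
  have hkL : k₀ * L ≤ Th * L := Nat.mul_le_mul_right _ hk₀.le
  have ht := htruth (parts N Th) (prof N L Th ε) i₀ (prof N L Th ε i₀)
    ⟨1 + Th * L, (Th + 1) * L, 1⟩ hi₀P
    (by rw [hT]; simp only [add_mul]; omega) (by rw [hT]; simp only; omega)
    (by simp only [add_mul]; omega) (by rw [hT]; simp only; constructor <;> intro <;> linarith)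
  rw [Function.update_eq_self] at ht
  refine le_trans ?_ ht
  change _ ≤ util D (parts N Th) (dev N L Th ε k₀) i₀ _
  rw [util_eq D hD _ _ _ _ (by rw [hT, hself]; simp only; omega) (by rw [hT, hself])]
  have hir := hIR (parts N Th) (dev N L Th ε k₀) i₀ hi₀P
  rw [util_eq D hD _ _ _ _ le_rfl le_rfl, hself] at hir
  simp only at hir
  rw [hT]
  simp only
  have hp : 1 / (N : ℝ) ≤ totP D (parts N Th) (dev N L Th ε k₀) i₀ := by
    have hcard : (((parts N Th).filter fun i =>
        (dev N L Th ε k₀ i).a = 1 + Th * L ∧ 0 < (dev N L Th ε k₀ i).w).card : ℝ) ≤ N := by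
      have hsub : ((parts N Th).filter fun i =>
        (dev N L Th ε k₀ i).a = 1 + Th * L ∧ 0 < (dev N L Th ε k₀ i).w) ⊆
        (parts N Th).filter fun i => dev N L Th ε k₀ i = ⟨1 + Th * L, (Th + 1) * L, 1⟩ := by
        intro i hi
        rw [Finset.mem_filter] at hi ⊢
        refine ⟨hi.1, ?_⟩
        obtain ⟨hiP, ha, hw⟩ := hi
        rcases env.1 i hiP with ⟨k, hk, h⟩ | ⟨k, hk, hk', h | h⟩
        · exfalso
          have : (dev N L Th ε k₀ i).a = 1 + k * L := by
            rcases h with h | h | h <;> rw [h]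
          rw [this, arr_inj _ _ _ hL] at ha
          omega
        · have : k = Th := by omega
          rw [h, this]
        · rw [h] at hw; simp only at hw; exfalso; linarith
      have h1 := Finset.card_le_card hsub
      have h2 := (env.2.2 Th le_rfl (by omega)).1
      have : ((parts N Th).filter fun i =>
        (dev N L Th ε k₀ i).a = 1 + Th * L ∧ 0 < (dev N L Th ε k₀ i).w).card ≤ N := by omega
      exact_mod_cast this
    have hle : ∑ i ∈ (parts N Th).filter (fun i =>
        (dev N L Th ε k₀ i).a = 1 + Th * L ∧ 0 < (dev N L Th ε k₀ i).w),
        totP D (parts N Th) (dev N L Th ε k₀) i =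
        ∑ i ∈ (parts N Th).filter (fun i =>
        (dev N L Th ε k₀ i).a = 1 + Th * L ∧ 0 < (dev N L Th ε k₀ i).w),
        totP D (parts N Th) (dev N L Th ε k₀) i₀ := by
      apply Finset.sum_congr rfl
      intro i hi
      rw [Finset.mem_filter] at hi
      obtain ⟨hiP, ha, hw⟩ := hi
      apply totP_symm D han _ _ _ _ hi₀P hiP
      rw [hself]
      rcases env.1 i hiP with ⟨k, hk, h⟩ | ⟨k, hk, hk', h | h⟩
      · exfalso
        have : (dev N L Th ε k₀ i).a = 1 + k * L := by
          rcases h with h | h | h <;> rw [h]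
        rw [this, arr_inj _ _ _ hL] at ha
        omega
      · have : k = Th := by omega
        rw [h, this]
      · rw [h] at hw; simp only at hw; exfalso; linarith
    rw [hle, Finset.sum_const, nsmul_eq_mul] at hreas
    have hN' : (0 : ℝ) < N := by exact_mod_cast hN
    rw [div_le_iff₀ hN', mul_comm]
    exact hreas.trans (mul_le_mul_of_nonneg_right hcard (totP_nonneg D hD _ _ _))
  have := totP_nonneg D hD (parts N Th) (dev N L Th ε k₀) i₀
  nlinarith

/-- **Impossibility with unbounded patience** (Theorem 5): no strongly truthful,
individual-rational, no-deficit, feasible, anonymous dynamic DA is reasonable in the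
simple environment when a bidder's patience can be unbounded. -/
theorem no_reasonable_truthful_da (D : DynDA) (hD : IsDynDA D)
    (htruth : Truthful D) (hIR : IR D) (hnd : NoDeficit D) (hfe : Feasible D)
    (han : Anonymous D) : ¬ Reasonable D := by
  rintro ⟨N, hN, L, hL, hreas⟩
  have hN' : (1 : ℝ) ≤ N := by exact_mod_cast hN
  obtain ⟨ε, hεdef⟩ : ∃ ε : ℝ, ε = 1 / (16 * (N : ℝ) ^ 2) := ⟨_, rfl⟩
  obtain ⟨Th, hTh⟩ : ∃ Th : ℕ, Th = 8 * N ^ 2 := ⟨_, rfl⟩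
  have hε : 0 < ε := by rw [hεdef]; positivity
  have hεN : ε * (16 * (N : ℝ) ^ 2) = 1 := by rw [hεdef]; field_simp
  have hε1 : ε < 1 := by nlinarith
  have hTh1 : 1 ≤ Th := by rw [hTh]; nlinarith
  have hpat : ∀ k < Th, 1 / (N : ℝ) ≤ util D (parts N Th) (prof N L Th ε)
      (2 * N * k + (2 * N - 1)) (prof N L Th ε (2 * N * k + (2 * N - 1))) := by
    intro k hk
    exact patient_util D hD htruth hIR han N L Th ε k hN hL hε hε1 hk
      (hreas Th 1 2 1 ε (1 + ε / 2) ((Th + 1) * L) (parts N Th) (dev N L Th ε k) hTh1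
        one_pos one_lt_two hε hε1 (by linarith) (dev_env N L Th ε k hN hL hε hε1 hk)
        Th (by omega)).1
  -- lower bound
  have hlow : (Th : ℝ) * (1 / N) ≤
      ∑ i ∈ parts N Th, util D (parts N Th) (prof N L Th ε) i (prof N L Th ε i) := by
    have hinj : Function.Injective (fun k => 2 * N * k + (2 * N - 1)) := by
      intro a b hab
      simp only at hab
      exact Nat.eq_of_mul_eq_mul_left (show 0 < 2 * N by omega) (by omega)
    have hsub : (Finset.range Th).image (fun k => 2 * N * k + (2 * N - 1)) ⊆ parts N Th := by
      intro i hi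
      obtain ⟨k, hk, rfl⟩ := Finset.mem_image.1 hi
      rw [mem_parts N Th _ hN, (pat_divmod N hN k).1]
      exact Or.inl (Finset.mem_range.1 hk)
    refine le_trans ?_ (Finset.sum_le_sum_of_subset_of_nonneg hsub fun i hi _ => hIR _ _ i hi)
    rw [Finset.sum_image fun a _ b _ h => hinj h]
    calc (Th : ℝ) * (1 / N) = ∑ k ∈ Finset.range Th, (1 / (N : ℝ)) := by simp
      _ ≤ _ := Finset.sum_le_sum fun k hk => hpat k (Finset.mem_range.1 hk)
  -- upper bound
  have hup := sum_util_le D hD hnd hfe (parts N Th) (prof N L Th ε) (2 + ε) (by linarith)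
    (by
      intro i _
      unfold prof
      split_ifs <;> simp only <;> linarith)
  have hup2 : ∑ i ∈ (parts N Th).filter (fun i => ¬ 0 < (prof N L Th ε i).w),
      totP D (parts N Th) (prof N L Th ε) i * (2 + ε + (prof N L Th ε i).w) ≤
      ∑ i ∈ parts N Th, (2 * ε + if i / (2 * N) = Th then 1 else 0) := by
    refine le_trans (Finset.sum_le_sum (g := fun i => 2 * ε + if i / (2 * N) = Th then 1 else 0)
      fun i hi => ?_) (Finset.sum_le_sum_of_subset_of_nonneg (Finset.filter_subset _ _)
        fun i _ _ => ?_)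
    · rw [Finset.mem_filter, mem_parts N Th i hN] at hi
      obtain ⟨hiP, hw⟩ := hi
      have hb : 0 ≤ 2 + ε + (prof N L Th ε i).w ∧ 2 + ε + (prof N L Th ε i).w ≤
          2 * ε + if i / (2 * N) = Th then 1 else 0 := by
        unfold prof at hw ⊢
        split_ifs at hw ⊢ <;> simp only at hw ⊢ <;>
          first | (exfalso; linarith) | (exfalso; omega) | (constructor <;> linarith)
      have h1 : totP D (parts N Th) (prof N L Th ε) i ≤ 1 := hD.2.1 _ _ i
      have h0 := totP_nonneg D hD (parts N Th) (prof N L Th ε) i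
      nlinarith [hb.1, hb.2]
    · have : (0 : ℝ) ≤ if i / (2 * N) = Th then 1 else 0 := by split_ifs <;> norm_num
      linarith
  have hup3 : ∑ i ∈ parts N Th, (2 * ε + if i / (2 * N) = Th then (1 : ℝ) else 0) ≤
      (2 * N * (Th + 1)) * (2 * ε) + 2 * N := by
    rw [Finset.sum_add_distrib, Finset.sum_const, nsmul_eq_mul, Finset.sum_boole]
    have c1 : ((parts N Th).card : ℝ) ≤ 2 * N * (Th + 1) := by
      have : (parts N Th).card ≤ 2 * N * (Th + 1) := by unfold parts; simp
      exact_mod_cast this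
    have c2 : (((parts N Th).filter fun i => i / (2 * N) = Th).card : ℝ) ≤ 2 * N := by
      have hs : ((parts N Th).filter fun i => i / (2 * N) = Th) ⊆
          Finset.Ico (2 * N * Th + 0) (2 * N * Th + 2 * N) := by
        intro i hi
        rw [← divmod_iff _ _ _ _ _ le_rfl]
        exact ⟨(Finset.mem_filter.1 hi).2, Nat.zero_le _, Nat.mod_lt _ (by omega)⟩
      have := Finset.card_le_card hs
      rw [Nat.card_Ico] at this
      have : ((parts N Th).filter fun i => i / (2 * N) = Th).card ≤ 2 * N := by omega
      exact_mod_cast this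
    have := mul_le_mul_of_nonneg_right c1 (show 0 ≤ 2 * ε by linarith)
    linarith
  have hfin := hlow.trans (hup.trans (hup2.trans hup3))
  have hThR : (Th : ℝ) = 8 * (N : ℝ) ^ 2 := by rw [hTh]; push_cast; ring
  rw [hThR] at hfin
  have e1 : 8 * (N : ℝ) ^ 2 * (1 / N) = 8 * N := by field_simp
  have e2 : 2 * (N : ℝ) * (8 * (N : ℝ) ^ 2 + 1) * (2 * ε) =
      2 * N * (ε * (16 * (N : ℝ) ^ 2)) + 4 * N * ε := by ring
  rw [e1, e2, hεN] at hfin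
  nlinarith

end UnboundedPatience
end
end
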